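/- Let l > 0, α > 0, L₁, L₂, L₃ ≥ 0, and let m : [0,∞) → ℝ satisfy m(z) ≥ α and |m(z₁) - m(z₂)| ≤ L₁|z₁ - z₂| for all z, z₁, z₂ ≥ 0. Let f : (0,l) × ℝ × ℝ → ℝ satisfy |f(x,u₂,v₂) - f(x,u₁,v₁)| ≤ L₂|u₂ - u₁| + L₃|v₂ - v₁| for all x ∈ (0,l) and u_i, v_i ∈ ℝ. Let u be a four times continuously differentiable solution of u'''' - m(∫₀ˡ u'²)u'' = f(x,u,u') on (0,l) with u(0)=u(l)=0, u''(0)=u''(l)=0, and let u_{k-1}, u_k be four times continuously differentiable functions with the same boundary conditions satisfying u_k'''' - m(∫₀ˡ u_{k-1}'²)u_k'' = f(x,u_{k-1},u_{k-1}') on (0,l). Suppose moreover that (∫₀ˡ u'²)^{1/2} ≤ c₁, (∫₀ˡ u_{k-1}'²)^{1/2} ≤ c₁ and (∫₀ˡ u_k'²)^{1/2} ≤ c₁ for some constant c₁ ≥ 0. Then, writing δu_j = u_j - u, one has (∫₀ˡ (δu_k)'² dx)^{1/2} ≤ q (∫₀ˡ (δu_{k-1})'² dx)^{1/2}, where q =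 (α + (π/l)²)^{-1} (2 c₁² L₁ + L₂ (l/π)² + L₃ (l/π)) (the contraction inequality of Section 6). -/

import Mathlib

open Real intervalIntegral

lemma aux_ii {f : ℝ → ℝ} (hf : Continuous f) (a b : ℝ) :
    IntervalIntegrable f MeasureTheory.volume a b := hf.intervalIntegrable a b

lemma aux_sq_nonneg (l : ℝ) (hl : 0 < l) (f : ℝ → ℝ) : 0 ≤ ∫ x in (0:ℝ)..l, f x ^ 2 :=
  intervalIntegral.integral_nonneg hl.le (fun x _ => sq_nonneg _)

lemma aux_cs (l : ℝ) (hl : 0 < l) (f g : ℝ → ℝ) (hf : Continuous f) (hg : Continuous g) :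
    |∫ x in (0:ℝ)..l, f x * g x| ≤
      Real.sqrt (∫ x in (0:ℝ)..l, f x ^ 2) * Real.sqrt (∫ x in (0:ℝ)..l, g x ^ 2) := by
  have key : ∀ t : ℝ, 0 ≤ (∫ x in (0:ℝ)..l, f x ^ 2) * (t * t)
      + (2 * ∫ x in (0:ℝ)..l, f x * g x) * t + ∫ x in (0:ℝ)..l, g x ^ 2 := by
    intro t
    have h := aux_sq_nonneg l hl (fun x => t * f x + g x)
    have e : (∫ x in (0:ℝ)..l, (t * f x + g x) ^ 2) =
        (∫ x in (0:ℝ)..l, f x ^ 2) * (t * t)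
      + (2 * ∫ x in (0:ℝ)..l, f x * g x) * t + ∫ x in (0:ℝ)..l, g x ^ 2 := by
      have e1 : ∀ x, (t * f x + g x) ^ 2 = ((t*t) * f x ^ 2 + (2*t) * (f x * g x)) + g x ^ 2 := by
        intro x; ring
      simp_rw [e1]
      rw [intervalIntegral.integral_add (aux_ii (by fun_prop) _ _) (aux_ii (by fun_prop) _ _),
        intervalIntegral.integral_add (aux_ii (by fun_prop) _ _) (aux_ii (by fun_prop) _ _),
        intervalIntegral.integral_const_mul, intervalIntegral.integral_const_mul]
      ring
    rw [← e]; exact h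
  have d := discrim_le_zero key
  rw [discrim] at d
  rw [← Real.sqrt_mul (aux_sq_nonneg l hl f)]
  apply Real.abs_le_sqrt
  linarith

lemma aux_wirt (l : ℝ) (hl : 0 < l) (w w1 : ℝ → ℝ) (hw : ∀ x, HasDerivAt w (w1 x) x)
    (hc : Continuous w1) (h0 : w 0 = 0) (h1 : w l = 0) :
    Real.sqrt (∫ x in (0:ℝ)..l, w x ^ 2) ≤ (l / π) * Real.sqrt (∫ x in (0:ℝ)..l, w1 x ^ 2) := by
  have hwc : Continuous w := continuous_iff_continuousAt.2 fun x => (hw x).continuousAt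
  have step : ∀ c : ℝ, 0 < c → c < π / l →
      c ^ 2 * (∫ x in (0:ℝ)..l, w x ^ 2) ≤ ∫ x in (0:ℝ)..l, w1 x ^ 2 := by
    intro c hc0 hcl
    have hcl' : c * l < π := by rwa [lt_div_iff₀ hl] at hcl
    have hcos : ∀ x ∈ Set.uIcc (0:ℝ) l, 0 < Real.cos (c * (x - l / 2)) := by
      intro x hx
      rw [Set.uIcc_of_le hl.le] at hx
      apply Real.cos_pos_of_mem_Ioo
      constructor <;> nlinarith [hx.1, hx.2]
    let g : ℝ → ℝ := fun x => -c * (Real.sin (c * (x - l / 2)) / Real.cos (c * (x - l / 2)))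
    have hgc : ContinuousOn g (Set.uIcc 0 l) := by
      apply ContinuousOn.mul continuousOn_const
      exact ContinuousOn.div (by fun_prop) (by fun_prop) (fun x hx => (hcos x hx).ne')
    have hd : ∀ x ∈ Set.uIcc (0:ℝ) l, HasDerivAt (fun x => g x * w x ^ 2)
        (w1 x ^ 2 - c ^ 2 * w x ^ 2 - (w1 x - g x * w x) ^ 2) x := by
      intro x hx
      have hne := (hcos x hx).ne'
      have hin : HasDerivAt (fun x : ℝ => c * (x - l / 2)) (c * 1) x :=
        ((hasDerivAt_id x).sub_const _).const_mul c
      have hg := ((hin.sin.div hin.cos hne).const_mul (-c)).mul ((hw x).pow 2)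
      refine hg.congr_deriv ?_
      have hs := Real.sin_sq_add_cos_sq (c * (x - l / 2))
      simp only [g, Pi.div_apply, Pi.pow_apply]
      set S := Real.sin (c * (x - l / 2))
      set C := Real.cos (c * (x - l / 2))
      have hS : S ^ 2 = 1 - C ^ 2 := by linarith
      field_simp
      ring_nf
      try rw [hS]
      try ring
    have hcont : ContinuousOn (fun x => (w1 x - g x * w x) ^ 2) (Set.uIcc 0 l) := by
      exact (hc.continuousOn.sub (hgc.mul hwc.continuousOn)).pow 2
    have I1 : IntervalIntegrable (fun x => w1 x ^ 2) MeasureTheory.volume 0 l := aux_ii (by fun_prop) _ _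
    have I2 : IntervalIntegrable (fun x => c ^ 2 * w x ^ 2) MeasureTheory.volume 0 l :=
      aux_ii (by fun_prop) _ _
    have I3 := hcont.intervalIntegrable (μ := MeasureTheory.volume)
    have ftc := intervalIntegral.integral_eq_sub_of_hasDerivAt hd ((I1.sub I2).sub I3)
    rw [intervalIntegral.integral_sub (I1.sub I2) I3, intervalIntegral.integral_sub I1 I2,
      intervalIntegral.integral_const_mul, h0, h1] at ftc
    have := aux_sq_nonneg l hl (fun x => w1 x - g x * w x)
    linarith
  have hk : 0 < π / l := div_pos Real.pi_pos hl
  have lim : (π / l) ^ 2 * (∫ x in (0:ℝ)..l, w x ^ 2) ≤ ∫ x in (0:ℝ)..l, w1 x ^ 2 := by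
    have ht : Filter.Tendsto (fun c : ℝ => c ^ 2 * (∫ x in (0:ℝ)..l, w x ^ 2))
        (nhdsWithin (π / l) (Set.Iio (π / l)))
        (nhds ((π / l) ^ 2 * (∫ x in (0:ℝ)..l, w x ^ 2))) := by
      apply Filter.Tendsto.mono_left _ nhdsWithin_le_nhds
      exact Continuous.tendsto (by fun_prop) _
    refine le_of_tendsto ht ?_
    filter_upwards [Ioo_mem_nhdsLT hk] with c hc
    exact step c hc.1 hc.2
  have : (∫ x in (0:ℝ)..l, w x ^ 2) ≤ (l / π) ^ 2 * ∫ x in (0:ℝ)..l, w1 x ^ 2 := by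
    have h2 := mul_le_mul_of_nonneg_left lim (sq_nonneg (l / π))
    have e : (l / π) ^ 2 * ((π / l) ^ 2 * (∫ x in (0:ℝ)..l, w x ^ 2)) = ∫ x in (0:ℝ)..l, w x ^ 2 := by
      have := Real.pi_ne_zero
      field_simp
    rwa [e] at h2
  calc _ ≤ Real.sqrt ((l / π) ^ 2 * ∫ x in (0:ℝ)..l, w1 x ^ 2) := Real.sqrt_le_sqrt this
    _ = _ := by rw [Real.sqrt_mul (sq_nonneg _), Real.sqrt_sq (div_pos hl Real.pi_pos).le]

lemma aux_derivs (u : ℝ → ℝ) (hu : ContDiff ℝ 4 u) :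
    (∀ x, HasDerivAt u (deriv u x) x) ∧ (∀ x, HasDerivAt (deriv u) (iteratedDeriv 2 u x) x) ∧
    (∀ x, HasDerivAt (iteratedDeriv 2 u) (iteratedDeriv 3 u x) x) ∧
    (∀ x, HasDerivAt (iteratedDeriv 3 u) (iteratedDeriv 4 u x) x) ∧
    Continuous (iteratedDeriv 4 u) := by
  have H : ∀ n : ℕ, n < 4 → ∀ x, HasDerivAt (iteratedDeriv n u) (iteratedDeriv (n+1) u x) x := by
    intro n hn x
    rw [iteratedDeriv_succ]
    exact ((hu.differentiable_iteratedDeriv n (by exact_mod_cast hn)) x).hasDerivAt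
  refine ⟨?_, ?_, H 2 (by norm_num), H 3 (by norm_num), hu.continuous_iteratedDeriv 4 (by norm_num)⟩
  · have := H 0 (by norm_num); simpa [iteratedDeriv_one] using this
  · have := H 1 (by norm_num); simpa [iteratedDeriv_one] using this

lemma aux_cont {w w1 : ℝ → ℝ} (hw : ∀ x, HasDerivAt w (w1 x) x) : Continuous w :=
  continuous_iff_continuousAt.2 fun x => (hw x).continuousAt

set_option maxHeartbeats 1000000 in
/-- integrated form -/
lemma aux_energy (l : ℝ) (hl : 0 < l) (α L₂ L₃ D a c₁ V : ℝ) (hα : 0 < α)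
    (hL₂ : 0 ≤ L₂) (hL₃ : 0 ≤ L₃) (ha : α ≤ a) (hV : 0 ≤ V)
    (w w1 w2 w3 w4 u1 u2 v v1 : ℝ → ℝ) (L₁ : ℝ)
    (hw : ∀ x, HasDerivAt w (w1 x) x) (hw1 : ∀ x, HasDerivAt w1 (w2 x) x)
    (hw2 : ∀ x, HasDerivAt w2 (w3 x) x) (hw3 : ∀ x, HasDerivAt w3 (w4 x) x)
    (hw4 : Continuous w4) (hu1 : ∀ x, HasDerivAt u1 (u2 x) x) (hu2 : Continuous u2)
    (hv : ∀ x, HasDerivAt v (v1 x) x) (hv1 : Continuous v1)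
    (w00 : w 0 = 0) (w0l : w l = 0) (w20 : w2 0 = 0) (w2l : w2 l = 0)
    (v0 : v 0 = 0) (vl : v l = 0)
    (hVd : V = Real.sqrt (∫ x in (0:ℝ)..l, v1 x ^ 2))
    (hU : Real.sqrt (∫ x in (0:ℝ)..l, u1 x ^ 2) ≤ c₁)
    (hD : |D| ≤ L₁ * (2 * c₁ * V))
    (hF : ∀ x ∈ Set.Ioo (0:ℝ) l, |w4 x - a * w2 x - D * u2 x| ≤ L₂ * |v x| + L₃ * |v1 x|) :
    Real.sqrt (∫ x in (0:ℝ)..l, w1 x ^ 2) ≤ (α + (π / l) ^ 2)⁻¹ *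
      (2 * c₁ ^ 2 * L₁ + L₂ * (l / π) ^ 2 + L₃ * (l / π)) * V := by
  have cw := aux_cont hw
  have cw1 := aux_cont hw1
  have cw2 := aux_cont hw2
  have cw3 := aux_cont hw3
  have cu1 := aux_cont hu1
  have cv := aux_cont hv
  -- integration by parts
  have p1 : (∫ x in (0:ℝ)..l, (w4 x * w x - w2 x ^ 2)) = 0 := by
    have := intervalIntegral.integral_eq_sub_of_hasDerivAt (a := 0) (b := l)
      (f := fun x => w3 x * w x - w2 x * w1 x) (f' := fun x => w4 x * w x - w2 x ^ 2)
      (fun x _ => (((hw3 x).mul (hw x)).sub ((hw2 x).mul (hw1 x))).congr_deriv (by ring))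
      (aux_ii (by fun_prop) _ _)
    rw [this]; simp [w00, w0l, w20, w2l]
  have p2 : (∫ x in (0:ℝ)..l, (w2 x * w x + w1 x ^ 2)) = 0 := by
    have := intervalIntegral.integral_eq_sub_of_hasDerivAt (a := 0) (b := l)
      (f := fun x => w1 x * w x) (f' := fun x => w2 x * w x + w1 x ^ 2)
      (fun x _ => ((hw1 x).mul (hw x)).congr_deriv (by ring))
      (aux_ii (by fun_prop) _ _)
    rw [this]; simp [w00, w0l]
  have p3 : (∫ x in (0:ℝ)..l, (u2 x * w x + u1 x * w1 x)) = 0 := by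
    have := intervalIntegral.integral_eq_sub_of_hasDerivAt (a := 0) (b := l)
      (f := fun x => u1 x * w x) (f' := fun x => u2 x * w x + u1 x * w1 x)
      (fun x _ => ((hu1 x).mul (hw x)).congr_deriv (by ring))
      (aux_ii (by fun_prop) _ _)
    rw [this]; simp [w00, w0l]
  rw [intervalIntegral.integral_sub (aux_ii (by fun_prop) _ _) (aux_ii (by fun_prop) _ _)] at p1
  rw [intervalIntegral.integral_add (aux_ii (by fun_prop) _ _) (aux_ii (by fun_prop) _ _)] at p2 p3
  have pF : (∫ x in (0:ℝ)..l, (w4 x - a * w2 x - D * u2 x) * w x) =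
      (∫ x in (0:ℝ)..l, w2 x ^ 2) + a * (∫ x in (0:ℝ)..l, w1 x ^ 2)
        + D * ∫ x in (0:ℝ)..l, u1 x * w1 x := by
    have e : ∀ x, (w4 x - a * w2 x - D * u2 x) * w x =
      (w4 x * w x - a * (w2 x * w x)) - D * (u2 x * w x) := by intro x; ring
    simp_rw [e]
    rw [intervalIntegral.integral_sub (aux_ii (by fun_prop) _ _) (aux_ii (by fun_prop) _ _),
      intervalIntegral.integral_sub (aux_ii (by fun_prop) _ _) (aux_ii (by fun_prop) _ _),
      intervalIntegral.integral_const_mul, intervalIntegral.integral_const_mul]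
    linear_combination p1 - a * p2 - D * p3
  have pFle : (∫ x in (0:ℝ)..l, (w4 x - a * w2 x - D * u2 x) * w x) ≤
      L₂ * (∫ x in (0:ℝ)..l, |v x| * |w x|) + L₃ * ∫ x in (0:ℝ)..l, |v1 x| * |w x| := by
    rw [← intervalIntegral.integral_const_mul, ← intervalIntegral.integral_const_mul,
      ← intervalIntegral.integral_add (aux_ii (by fun_prop) _ _) (aux_ii (by fun_prop) _ _)]
    apply intervalIntegral.integral_mono_on_of_le_Ioo hl.le (aux_ii (by fun_prop) _ _)
      (aux_ii (by fun_prop) _ _)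
    intro x hx
    calc _ ≤ |(w4 x - a * w2 x - D * u2 x) * w x| := le_abs_self _
      _ = |w4 x - a * w2 x - D * u2 x| * |w x| := abs_mul _ _
      _ ≤ (L₂ * |v x| + L₃ * |v1 x|) * |w x| :=
        mul_le_mul_of_nonneg_right (hF x hx) (abs_nonneg _)
      _ = _ := by ring
  have c1 := (le_abs_self _).trans (aux_cs l hl (fun x => |v x|) (fun x => |w x|) cv.abs cw.abs)
  have c2 := (le_abs_self _).trans (aux_cs l hl (fun x => |v1 x|) (fun x => |w x|) hv1.abs cw.abs)
  have c3 := aux_cs l hl u1 w1 cu1 cw1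
  have c4 := aux_cs l hl w2 w cw2 cw
  simp only [sq_abs] at c1 c2
  have W := aux_wirt l hl w w1 hw cw1 w00 w0l
  have Wv := aux_wirt l hl v v1 hv hv1 v0 vl
  have s1 := Real.sq_sqrt (aux_sq_nonneg l hl w1)
  have s2 := Real.sq_sqrt (aux_sq_nonneg l hl w2)
  rw [← hVd] at Wv c2
  have n0 := Real.sqrt_nonneg (∫ x in (0:ℝ)..l, w x ^ 2)
  have n1 := Real.sqrt_nonneg (∫ x in (0:ℝ)..l, w1 x ^ 2)
  have n2 := Real.sqrt_nonneg (∫ x in (0:ℝ)..l, w2 x ^ 2)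
  have nv := Real.sqrt_nonneg (∫ x in (0:ℝ)..l, v x ^ 2)
  have nu := Real.sqrt_nonneg (∫ x in (0:ℝ)..l, u1 x ^ 2)
  generalize Real.sqrt (∫ x in (0:ℝ)..l, w x ^ 2) = Z at *
  generalize Real.sqrt (∫ x in (0:ℝ)..l, w1 x ^ 2) = X at *
  generalize Real.sqrt (∫ x in (0:ℝ)..l, w2 x ^ 2) = Y at *
  generalize Real.sqrt (∫ x in (0:ℝ)..l, v x ^ 2) = T at *
  generalize Real.sqrt (∫ x in (0:ℝ)..l, u1 x ^ 2) = U at *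
  have hr : 0 < l / π := div_pos hl Real.pi_pos
  have hkr : (π / l) * (l / π) = 1 := by
    have := Real.pi_ne_zero
    field_simp
  have hk : 0 < π / l := div_pos Real.pi_pos hl
  generalize l / π = r at *
  generalize π / l = k at *
  rcases n1.eq_or_lt with h | hX
  · rw [← h]
    have hcc : 0 ≤ c₁ := nu.trans hU
    rcases hV.eq_or_lt with h' | hV'
    · rw [← h']; simp
    · have : 0 ≤ L₁ * c₁ := by
        by_contra hn
        push Not at hn
        have h5 := abs_nonneg D
        have h6 := mul_neg_of_neg_of_pos hn hV'
        linarith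
      have : 0 ≤ 2 * c₁ ^ 2 * L₁ := by
        have h7 := mul_nonneg this hcc
        linarith
      positivity
  have hcc : 0 ≤ c₁ := nu.trans hU
  have hXY : k * X ≤ Y := by
    have h1 : X ^ 2 ≤ Y * Z := by
      rw [s1]; have := (neg_le_abs _).trans c4; linarith
    have h2 : X * X ≤ (r * Y) * X := by
      have h4 := mul_le_mul_of_nonneg_left W n2
      linarith
    have h3 : X ≤ r * Y := le_of_mul_le_mul_right h2 hX
    calc k * X ≤ k * (r * Y) := by gcongr
      _ = Y := by rw [← mul_assoc, hkr, one_mul]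
  have hY2 : (k * X) ^ 2 ≤ Y ^ 2 := by gcongr
  have haX : α * X ^ 2 ≤ a * X ^ 2 := by gcongr
  have hDD : -(D * ∫ x in (0:ℝ)..l, u1 x * w1 x) ≤ (L₁ * (2 * c₁ * V)) * (c₁ * X) := by
    calc _ ≤ |D * ∫ x in (0:ℝ)..l, u1 x * w1 x| := neg_le_abs _
      _ = |D| * |∫ x in (0:ℝ)..l, u1 x * w1 x| := abs_mul _ _
      _ ≤ (L₁ * (2 * c₁ * V)) * (c₁ * X) := by
        apply mul_le_mul hD (c3.trans (by gcongr)) (abs_nonneg _) ((abs_nonneg _).trans hD)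
  have e1 : L₂ * (∫ x in (0:ℝ)..l, |v x| * |w x|) ≤ L₂ * ((r * V) * (r * X)) := by
    gcongr
    exact c1.trans (by gcongr)
  have e2 : L₃ * (∫ x in (0:ℝ)..l, |v1 x| * |w x|) ≤ L₃ * (V * (r * X)) := by
    gcongr
    exact c2.trans (by gcongr)
  have fin : ((α + k ^ 2) * X) * X ≤
      ((2 * c₁ ^ 2 * L₁ + L₂ * r ^ 2 + L₃ * r) * V) * X := by
    rw [pF, ← s1, ← s2] at pFle
    linarith
  have fin2 := le_of_mul_le_mul_right fin hX
  have hpos : 0 < α + k ^ 2 := by positivity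
  rw [mul_assoc, ← div_eq_inv_mul, le_div_iff₀ hpos]
  linarith

/-- The contraction inequality of Section 6:
`‖δu_k‖₁ ≤ q ‖δu_{k-1}‖₁` with
`q = (α + (π/l)²)⁻¹ (2 c₁² L₁ + L₂ (l/π)² + L₃ (l/π))`. -/
theorem contraction_inequality
    (l : ℝ) (hl : 0 < l) (α : ℝ) (hα : 0 < α)
    (L₁ L₂ L₃ : ℝ) (hL₁ : 0 ≤ L₁) (hL₂ : 0 ≤ L₂) (hL₃ : 0 ≤ L₃)
    (m : ℝ → ℝ) (hm : ∀ z : ℝ, 0 ≤ z → α ≤ m z)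
    (hmLip : ∀ z₁ z₂ : ℝ, 0 ≤ z₁ → 0 ≤ z₂ → |m z₁ - m z₂| ≤ L₁ * |z₁ - z₂|)
    (f : ℝ → ℝ → ℝ → ℝ)
    (hfLip : ∀ x ∈ Set.Ioo (0:ℝ) l, ∀ u₁ v₁ u₂ v₂ : ℝ,
      |f x u₂ v₂ - f x u₁ v₁| ≤ L₂ * |u₂ - u₁| + L₃ * |v₂ - v₁|)
    (u : ℝ → ℝ) (hu : ContDiff ℝ 4 u)
    (hu0 : u 0 = 0) (hul : u l = 0)
    (hu0'' : iteratedDeriv 2 u 0 = 0) (hul'' : iteratedDeriv 2 u l = 0)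
    (hueq : ∀ x ∈ Set.Ioo (0:ℝ) l,
      iteratedDeriv 4 u x
        - m (∫ t in (0:ℝ)..l, (deriv u t) ^ 2) * iteratedDeriv 2 u x
        = f x (u x) (deriv u x))
    (uprev uk : ℝ → ℝ)
    (huprev : ContDiff ℝ 4 uprev) (huk : ContDiff ℝ 4 uk)
    (hp0 : uprev 0 = 0) (hpl : uprev l = 0)
    (hp0'' : iteratedDeriv 2 uprev 0 = 0) (hpl'' : iteratedDeriv 2 uprev l = 0)
    (hk0 : uk 0 = 0) (hkl : uk l = 0)
    (hk0'' : iteratedDeriv 2 uk 0 = 0) (hkl'' : iteratedDeriv 2 uk l = 0)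
    (hkeq : ∀ x ∈ Set.Ioo (0:ℝ) l,
      iteratedDeriv 4 uk x
        - m (∫ t in (0:ℝ)..l, (deriv uprev t) ^ 2) * iteratedDeriv 2 uk x
        = f x (uprev x) (deriv uprev x))
    (c₁ : ℝ) (hc₁ : 0 ≤ c₁)
    (hbu : Real.sqrt (∫ x in (0:ℝ)..l, (deriv u x) ^ 2) ≤ c₁)
    (hbp : Real.sqrt (∫ x in (0:ℝ)..l, (deriv uprev x) ^ 2) ≤ c₁)
    (hbk : Real.sqrt (∫ x in (0:ℝ)..l, (deriv uk x) ^ 2) ≤ c₁)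
    (q : ℝ)
    (hq : q = (α + (π / l) ^ 2)⁻¹ *
      (2 * c₁ ^ 2 * L₁ + L₂ * (l / π) ^ 2 + L₃ * (l / π))) :
    Real.sqrt (∫ x in (0:ℝ)..l, (deriv (fun t => uk t - u t) x) ^ 2)
      ≤ q * Real.sqrt (∫ x in (0:ℝ)..l, (deriv (fun t => uprev t - u t) x) ^ 2) := by
  obtain ⟨du0, du1, du2, du3, du4⟩ := aux_derivs u hu
  obtain ⟨dp0, dp1, dp2, dp3, dp4⟩ := aux_derivs uprev huprev
  obtain ⟨dk0, dk1, dk2, dk3, dk4⟩ := aux_derivs uk huk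
  have ek : (deriv fun t => uk t - u t) = fun x => deriv uk x - deriv u x :=
    funext fun x => ((dk0 x).sub (du0 x)).deriv
  have ep : (deriv fun t => uprev t - u t) = fun x => deriv uprev x - deriv u x :=
    funext fun x => ((dp0 x).sub (du0 x)).deriv
  rw [ek, ep, hq]
  have cu1 := aux_cont du1
  have cp1 := aux_cont dp1
  have cu2 := aux_cont du2
  have nP := aux_sq_nonneg l hl (deriv uprev)
  have nU := aux_sq_nonneg l hl (deriv u)
  refine aux_energy l hl α L₂ L₃
    (m (∫ t in (0:ℝ)..l, (deriv uprev t) ^ 2) - m (∫ t in (0:ℝ)..l, (deriv u t) ^ 2))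
    (m (∫ t in (0:ℝ)..l, (deriv uprev t) ^ 2)) c₁ _ hα hL₂ hL₃ (hm _ nP) (Real.sqrt_nonneg _)
    (fun x => uk x - u x) (fun x => deriv uk x - deriv u x)
    (fun x => iteratedDeriv 2 uk x - iteratedDeriv 2 u x)
    (fun x => iteratedDeriv 3 uk x - iteratedDeriv 3 u x)
    (fun x => iteratedDeriv 4 uk x - iteratedDeriv 4 u x)
    (deriv u) (iteratedDeriv 2 u) (fun x => uprev x - u x)
    (fun x => deriv uprev x - deriv u x) L₁
    (fun x => (dk0 x).sub (du0 x)) (fun x => (dk1 x).sub (du1 x)) (fun x => (dk2 x).sub (du2 x))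
    (fun x => (dk3 x).sub (du3 x)) (dk4.sub du4) du1 cu2 (fun x => (dp0 x).sub (du0 x))
    (cp1.sub cu1) (by simp [hk0, hu0]) (by simp [hkl, hul]) (by simp [hk0'', hu0''])
    (by simp [hkl'', hul'']) (by simp [hp0, hu0]) (by simp [hpl, hul]) rfl hbu ?_ ?_
  · refine (hmLip _ _ nP nU).trans (mul_le_mul_of_nonneg_left ?_ hL₁)
    have e : (∫ t in (0:ℝ)..l, (deriv uprev t) ^ 2) - (∫ t in (0:ℝ)..l, (deriv u t) ^ 2) =
        (∫ t in (0:ℝ)..l, (deriv uprev t - deriv u t) * deriv uprev t) +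
        ∫ t in (0:ℝ)..l, (deriv uprev t - deriv u t) * deriv u t := by
      rw [← intervalIntegral.integral_add (aux_ii (by fun_prop) _ _) (aux_ii (by fun_prop) _ _),
        ← intervalIntegral.integral_sub (aux_ii (by fun_prop) _ _) (aux_ii (by fun_prop) _ _)]
      congr 1
      funext t
      ring
    rw [e]
    have a1 := aux_cs l hl _ _ (cp1.sub cu1) cp1
    have a2 := aux_cs l hl _ _ (cp1.sub cu1) cu1
    have nV := Real.sqrt_nonneg (∫ x in (0:ℝ)..l, (deriv uprev x - deriv u x) ^ 2)
    have b1 := mul_le_mul_of_nonneg_left hbp nV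
    have b2 := mul_le_mul_of_nonneg_left hbu nV
    refine (abs_add_le _ _).trans ?_
    simp only [Pi.sub_apply] at a1 a2
    beta_reduce
    linarith
  · intro x hx
    have h := hfLip x hx (u x) (deriv u x) (uprev x) (deriv uprev x)
    rw [← hueq x hx, ← hkeq x hx] at h
    refine le_trans (le_of_eq ?_) h
    congr 1
    ring
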